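/- Let m ≥ 2 be an integer and let w be an infinite binary word that is Sturmian or periodic, with slope α = π(w); set β = 1/(m+α). Then for every real ε > 0 there exists an integer n₀ such that for all n ≥ n₀ the following holds: if there exist integers i ≥ 0, r ≥ 0, and s₀, s' with 0 ≤ s₀ ≤ m, 0 ≤ s' ≤ m and n = s₀ + s' + 2 + m·r + (w_{i+1} + ⋯ + w_{i+r}), then β − ε ≤ (r+1)/n ≤ β + ε. -/

import Mathlib

/-- An infinite binary word: every letter is `0` or `1`. -/
def IsBinaryWord (w : ℕ → ℕ) : Prop := ∀ i, w i ≤ 1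

/-- The complexity function of `w`: the number of distinct factors (subwords) of
length `n`, a factor of length `n` being `w (i) w (i+1) ⋯ w (i+n-1)` for some `i`. -/
noncomputable def Complexity (w : ℕ → ℕ) (n : ℕ) : ℕ :=
  Set.ncard { f : Fin n → ℕ | ∃ i : ℕ, f = fun j : Fin n => w (i + j) }

/-- `w` is Sturmian: `Comp_w(n) = n + 1` for all `n ≥ 1`. -/
noncomputable def IsSturmian (w : ℕ → ℕ) : Prop := ∀ n : ℕ, 1 ≤ n → Complexity w n = n + 1

/-- `w` is periodic with period `T ≥ 1`. -/
def IsPeriodicWord (w : ℕ → ℕ) (T : ℕ) : Prop := 1 ≤ T ∧ ∀ i, w (i + T) = w i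

/-- The slope of `w` is `α`: the averages of the first `n` letters tend to `α`. -/
def HasSlope (w : ℕ → ℕ) (α : ℝ) : Prop :=
  Filter.Tendsto (fun n : ℕ => (∑ j ∈ Finset.range n, (w j : ℝ)) / n)
    Filter.atTop (nhds α)

/-- The height of the factor of `w` of length `r` starting at position `i`. -/
def factorHeight (w : ℕ → ℕ) (i r : ℕ) : ℕ := ∑ j ∈ Finset.range r, w (i + j)

/-- The factor of `w` of length `n` starting at position `i`. -/
def factorAt (w : ℕ → ℕ) (n i : ℕ) : Fin n → ℕ := fun j => w (i + j)

theorem factorAt_eq_iff {w : ℕ → ℕ} {n i j : ℕ} :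
    factorAt w n i = factorAt w n j ↔ ∀ k < n, w (i + k) = w (j + k) := by
  constructor
  · intro h k hk
    exact congrFun h ⟨k, hk⟩
  · intro h
    funext k
    exact h k k.2

theorem complexity_eq_ncard_range (w : ℕ → ℕ) (n : ℕ) :
    Complexity w n = (Set.range (factorAt w n)).ncard := by
  unfold Complexity
  congr 1
  ext f
  constructor
  · rintro ⟨i, rfl⟩
    exact ⟨i, rfl⟩
  · rintro ⟨i, rfl⟩
    exact ⟨i, rfl⟩

theorem IsBinaryWord.finite_range_factorAt {w : ℕ → ℕ} (hw : IsBinaryWord w) (n : ℕ) :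
    (Set.range (factorAt w n)).Finite := by
  refine (Set.Finite.pi' (fun _ : Fin n => Set.finite_Iic 1)).subset ?_
  rintro _ ⟨i, rfl⟩ j
  exact hw _

theorem factorHeight_succ (w : ℕ → ℕ) (i r : ℕ) :
    factorHeight w i (r + 1) = factorHeight w i r + w (i + r) :=
  Finset.sum_range_succ _ _

theorem factorHeight_add (w : ℕ → ℕ) (i a b : ℕ) :
    factorHeight w i (a + b) = factorHeight w i a + factorHeight w (i + a) b := by
  simp [factorHeight, Finset.sum_range_add, add_assoc]

theorem factorHeight_one (w : ℕ → ℕ) (i : ℕ) : factorHeight w i 1 = w i := by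
  simp [factorHeight]

theorem IsBinaryWord.factorHeight_le {w : ℕ → ℕ} (hw : IsBinaryWord w) (i r : ℕ) :
    factorHeight w i r ≤ r := by
  simpa [factorHeight] using
    Finset.sum_le_card_nsmul (Finset.range r) (fun j => w (i + j)) 1 (fun j _ => hw _)

/-- A Sturmian word is not eventually periodic. -/
theorem IsSturmian.not_eventually_periodic {w : ℕ → ℕ} (hs : IsSturmian w) {M q : ℕ}
    (hq : 0 < q) (h : ∀ z, M ≤ z → w (z + q) = w z) : False := by
  have hc := hs (M + q) (by omega)
  rw [complexity_eq_ncard_range] at hc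
  have key : ∀ i, ∃ j < M + q, factorAt w (M + q) i = factorAt w (M + q) j := by
    intro i
    induction i using Nat.strong_induction_on with
    | _ i ih =>
      by_cases hi : i < M + q
      · exact ⟨i, hi, rfl⟩
      · obtain ⟨j, hj, e⟩ := ih (i - q) (by omega)
        refine ⟨j, hj, Eq.trans (factorAt_eq_iff.2 fun k _ => ?_) e⟩
        rw [← h (i - q + k) (by omega)]
        congr 1
        omega
  have hsub : Set.range (factorAt w (M + q)) ⊆
      ((Finset.range (M + q)).image (factorAt w (M + q)) : Finset _) := by
    rintro _ ⟨i, rfl⟩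
    obtain ⟨j, hj, e⟩ := key i
    rw [e]
    exact Finset.mem_coe.2 (Finset.mem_image_of_mem _ (Finset.mem_range.2 hj))
  have h1 := Set.ncard_le_ncard hsub (Finset.finite_toSet _)
  rw [Set.ncard_coe_finset] at h1
  have h2 : ((Finset.range (M + q)).image (factorAt w (M + q))).card ≤ M + q := by
    simpa using Finset.card_image_le (s := Finset.range (M + q)) (f := factorAt w (M + q))
  omega

/-- Two right special factors of the same length of a Sturmian word coincide. -/
theorem IsSturmian.right_special_unique {w : ℕ → ℕ} (hw : IsBinaryWord w) (hs : IsSturmian w)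
    {n i i' j j' : ℕ} (hn : 1 ≤ n)
    (hi : factorAt w n i = factorAt w n i') (hi' : w (i + n) ≠ w (i' + n))
    (hj : factorAt w n j = factorAt w n j') (hj' : w (j + n) ≠ w (j' + n)) :
    factorAt w n i = factorAt w n j := by
  by_contra hne
  have c1 := hs n hn
  have c2 := hs (n + 1) (by omega)
  rw [complexity_eq_ncard_range] at c1 c2
  set F := Set.range (factorAt w (n + 1))
  have hfin : F.Finite := hw.finite_range_factorAt _
  have hlast : ∀ {a b}, factorAt w (n + 1) a = factorAt w (n + 1) b → w (a + n) = w (b + n) :=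
    fun h => factorAt_eq_iff.1 h n (by omega)
  have hinit : ∀ {a b}, factorAt w (n + 1) a = factorAt w (n + 1) b →
      factorAt w n a = factorAt w n b :=
    fun h => factorAt_eq_iff.2 fun k hk => factorAt_eq_iff.1 h k (by omega)
  have hpair : ({factorAt w (n + 1) i, factorAt w (n + 1) j} : Set _) ⊆ F := by
    rintro _ (rfl | rfl)
    · exact ⟨i, rfl⟩
    · exact ⟨j, rfl⟩
  have hd := Set.ncard_sdiff_add_ncard_of_subset hpair hfin
  rw [Set.ncard_pair (fun e => hne (hinit e))] at hd
  have hsub : Set.range (factorAt w n) ⊆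
      (fun f : Fin (n + 1) → ℕ => fun k : Fin n => f k.castSucc) ''
        (F \ {factorAt w (n + 1) i, factorAt w (n + 1) j}) := by
    rintro _ ⟨z, rfl⟩
    by_cases h1 : factorAt w (n + 1) z = factorAt w (n + 1) i
    · refine ⟨factorAt w (n + 1) i', ⟨⟨i', rfl⟩, ?_⟩, ?_⟩
      · rintro (e | e)
        · exact hi' (hlast e).symm
        · exact hne (hi.trans (hinit e))
      · exact ((hinit h1).trans hi).symm
    · by_cases h2 : factorAt w (n + 1) z = factorAt w (n + 1) j
      · refine ⟨factorAt w (n + 1) j', ⟨⟨j', rfl⟩, ?_⟩, ?_⟩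
        · rintro (e | e)
          · exact hne (hj.trans (hinit e)).symm
          · exact hj' (hlast e).symm
        · exact ((hinit h2).trans hj).symm
      · exact ⟨factorAt w (n + 1) z, ⟨⟨z, rfl⟩, by rintro (e | e); exacts [h1 e, h2 e]⟩, rfl⟩
  have h3 := (Set.ncard_le_ncard hsub ((hfin.sdiff).image _)).trans
    (Set.ncard_image_le hfin.sdiff)
  omega

/-- A Sturmian word has a right special factor of every positive length. -/
theorem IsSturmian.exists_right_special {w : ℕ → ℕ} (hs : IsSturmian w) {n : ℕ} (hn : 1 ≤ n) :
    ∃ i i', factorAt w n i = factorAt w n i' ∧ w (i + n) ≠ w (i' + n) := by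
  by_contra! hcon
  have c1 := hs n hn
  have c2 := hs (n + 1) (by omega)
  rw [complexity_eq_ncard_range] at c1 c2
  have hinj : Set.InjOn (fun f : Fin (n + 1) → ℕ => fun k : Fin n => f k.castSucc)
      (Set.range (factorAt w (n + 1))) := by
    rintro _ ⟨a, rfl⟩ _ ⟨b, rfl⟩ e
    have e' : factorAt w n a = factorAt w n b := e
    refine factorAt_eq_iff.2 fun k hk => ?_
    rcases Nat.lt_succ_iff_lt_or_eq.1 hk with h | rfl
    · exact factorAt_eq_iff.1 e' k h
    · exact hcon a b e'
  have h1 := hinj.ncard_image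
  rw [← Set.range_comp] at h1
  have h2 : (Set.range ((fun f : Fin (n + 1) → ℕ => fun k : Fin n => f k.castSucc) ∘
      factorAt w (n + 1))) = Set.range (factorAt w n) := rfl
  rw [h2] at h1
  omega

/-- A Sturmian word has no palindrome `p` with both `apa` and `bpb` as factors (`a ≠ b`), where
`bp` is right special; here `apa` and `bpb` occur at `x` and `y`, and `bp` also occurs at `i`. -/
theorem IsSturmian.no_palindromic_bispecial {w : ℕ → ℕ} (hw : IsBinaryWord w)
    (hs : IsSturmian w) {n x i i' : ℕ}
    (hpal : ∀ k < n, w (x + 1 + k) = w (x + 1 + (n - 1 - k)))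
    (hxe : w (x + n + 1) = w x)
    (hi : factorAt w (n + 1) i = factorAt w (n + 1) i') (hi' : w (i + (n + 1)) ≠ w (i' + (n + 1)))
    (hix : w i ≠ w x) (hip : ∀ k < n, w (i + 1 + k) = w (x + 1 + k)) : False := by
  have nonspecial : ∀ d ≤ n + 1, factorAt w (n + 1) (x + d) ≠ factorAt w (n + 1) i := by
    intro d hd e
    rw [factorAt_eq_iff] at e
    have e0 := e 0 (by omega)
    simp only [add_zero] at e0
    rcases Nat.eq_zero_or_pos d with rfl | hd0
    · exact hix e0.symm
    rcases Nat.lt_or_ge n d with h | h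
    · obtain rfl : d = n + 1 := by omega
      exact hix (e0.symm.trans hxe)
    · have e1 := e (n + 1 - d) (by omega)
      have e2 := hip (n - d) (by omega)
      have e3 := hpal (d - 1) (by omega)
      rw [show x + d + (n + 1 - d) = x + n + 1 by omega] at e1
      rw [show i + (n + 1 - d) = i + 1 + (n - d) by omega] at e1
      rw [show x + 1 + (d - 1) = x + d by omega,
        show n - 1 - (d - 1) = n - d by omega] at e3
      exact hix (by rw [← e0, e3, ← e2, ← e1, hxe])
  obtain ⟨d, hd, d', hd', hne, heq⟩ : ∃ d ∈ Finset.range (n + 2), ∃ d' ∈ Finset.range (n + 2),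
      d ≠ d' ∧ factorAt w (n + 1) (x + d) = factorAt w (n + 1) (x + d') := by
    have hfin := hw.finite_range_factorAt (n + 1)
    have c := hs (n + 1) (by omega)
    rw [complexity_eq_ncard_range, Set.ncard_eq_toFinset_card _ hfin] at c
    apply Finset.exists_ne_map_eq_of_card_lt_of_maps_to
      (t := hfin.toFinset.erase (factorAt w (n + 1) i))
    · rw [Finset.card_erase_of_mem (by simp), c]
      simp
    · intro d hd
      have hd : d < n + 2 := Finset.mem_range.1 hd
      simp only [Finset.coe_erase, Set.Finite.coe_toFinset]
      exact ⟨⟨x + d, rfl⟩, nonspecial d (by omega)⟩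
  rw [Finset.mem_range] at hd hd'
  wlog hlt : d < d' generalizing d d'
  · exact this d' hd' d hd hne.symm heq.symm (by omega)
  have step : ∀ k, factorAt w (n + 1) (x + d + k) = factorAt w (n + 1) (x + d' + k) ∧
      factorAt w (n + 1) (x + d + k) ≠ factorAt w (n + 1) i := by
    intro k
    induction k using Nat.strong_induction_on with
    | _ k ih =>
      constructor
      · rcases k with _ | k
        · exact heq
        · obtain ⟨h1, h2⟩ := ih k (by omega)
          refine factorAt_eq_iff.2 fun l hl => ?_
          have h3 : w (x + d + k + (n + 1)) = w (x + d' + k + (n + 1)) := by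
            by_contra h
            exact h2 (hs.right_special_unique hw (by omega) h1 h hi hi')
          rcases Nat.lt_succ_iff_lt_or_eq.1 hl with h | rfl
          · have := factorAt_eq_iff.1 h1 (l + 1) (by omega)
            convert this using 2 <;> omega
          · convert h3 using 2 <;> omega
      · by_cases hk : k < d' - d
        · rw [add_assoc]
          exact nonspecial _ (by omega)
        · obtain ⟨h1, h2⟩ := ih (k - (d' - d)) (by omega)
          rw [h1] at h2
          rwa [show x + d' + (k - (d' - d)) = x + d + k by omega] at h2
  refine hs.not_eventually_periodic (M := x + d) (q := d' - d) (by omega) fun z hz => ?_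
  have := factorAt_eq_iff.1 (step (z - (x + d))).1 0 (by omega)
  rw [← show x + d + (z - (x + d)) + 0 = z by omega, this]
  congr 1
  omega

/-- Sturmian words are balanced. -/
theorem IsSturmian.balanced {w : ℕ → ℕ} (hw : IsBinaryWord w) (hs : IsSturmian w) (i j r : ℕ) :
    factorHeight w i r ≤ factorHeight w j r + 1 := by
  induction r using Nat.strong_induction_on generalizing i j with
  | _ r ih =>
  by_contra hcon
  have b1 := hw.factorHeight_le i r
  obtain ⟨n, rfl⟩ : ∃ n, r = n + 2 := ⟨r - 2, by omega⟩
  have diff : ∀ k, 1 ≤ k → k ≤ n + 1 → factorHeight w i k = factorHeight w j k + 1 := by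
    intro k h1 h2
    have a1 := ih k (by omega) i j
    have a2 := ih (n + 2 - k) (by omega) (i + k) (j + k)
    have a3 := factorHeight_add w i k (n + 2 - k)
    have a4 := factorHeight_add w j k (n + 2 - k)
    rw [show k + (n + 2 - k) = n + 2 by omega] at a3 a4
    omega
  have hi0 := hw i
  have hj0 := hw j
  have h0 := diff 1 le_rfl (by omega)
  rw [factorHeight_one, factorHeight_one] at h0
  have hmid : ∀ k < n, w (i + 1 + k) = w (j + 1 + k) := by
    intro k hk
    have d1 := diff (k + 1) (by omega) (by omega)
    have d2 := diff (k + 1 + 1) (by omega) (by omega)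
    rw [factorHeight_succ w i (k + 1), factorHeight_succ w j (k + 1)] at d2
    rw [add_assoc, add_assoc, add_comm 1 k]
    omega
  have hend : w (i + n + 1) = 1 ∧ w (j + n + 1) = 0 := by
    have d1 := diff (n + 1) (by omega) le_rfl
    have := hw (i + n + 1)
    rw [factorHeight_succ w i (n + 1), factorHeight_succ w j (n + 1), ← add_assoc,
      ← add_assoc] at hcon
    omega
  have hpal : ∀ k < n, w (i + 1 + k) = w (i + 1 + (n - 1 - k)) := by
    intro k
    induction k using Nat.strong_induction_on with
    | _ k ihk =>
    intro hk
    have hsum : factorHeight w (i + 1) k = factorHeight w (i + 1 + (n - k)) k := by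
      unfold factorHeight
      rw [← Finset.sum_range_reflect]
      refine Finset.sum_congr rfl fun l hl => ?_
      rw [Finset.mem_range] at hl
      rw [ihk (k - 1 - l) (by omega) (by omega)]
      congr 1
      omega
    have hsumj : ∀ a, a + k ≤ n →
        factorHeight w (j + 1 + a) k = factorHeight w (i + 1 + a) k := by
      intro a ha
      refine Finset.sum_congr rfl fun l hl => ?_
      rw [Finset.mem_range] at hl
      rw [add_assoc, add_assoc (i + 1), hmid (a + l) (by omega)]
    have expand : ∀ z, factorHeight w z (1 + k + 1) =
        w z + factorHeight w (z + 1) k + w (z + 1 + k) := by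
      intro z
      rw [factorHeight_succ, factorHeight_add, factorHeight_one, ← add_assoc]
    have hmidk := hmid k hk
    have hmidk' := hmid (n - 1 - k) (by omega)
    have s1 := hsumj 0 (by omega)
    have s2 := hsumj (n - k) (by omega)
    simp only [add_zero] at s1
    have p1 := ih (1 + k + 1) (by omega) i (j + 1 + (n - 1 - k))
    have p2 := ih (1 + k + 1) (by omega) (i + 1 + (n - 1 - k)) j
    rw [expand, expand] at p1 p2
    rw [show j + 1 + (n - 1 - k) + 1 = j + 1 + (n - k) by omega,
      show j + 1 + (n - k) + k = j + n + 1 by omega] at p1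
    rw [show i + 1 + (n - 1 - k) + 1 = i + 1 + (n - k) by omega,
      show i + 1 + (n - k) + k = i + n + 1 by omega] at p2
    have := hw (i + 1 + k)
    have := hw (i + 1 + (n - 1 - k))
    omega
  obtain ⟨z, z', hz, hz'⟩ := hs.exists_right_special (n := n + 1) (by omega)
  have hzi : ∀ k < n, w (z + 1 + k) = w (i + 1 + k) := by
    rcases Nat.eq_zero_or_pos n with rfl | hn
    · intro k hk
      omega
    · refine factorAt_eq_iff.1 (hs.right_special_unique hw (i' := z' + 1) (j' := j + 1) hn
        (factorAt_eq_iff.2 fun k hk => ?_) ?_ (factorAt_eq_iff.2 hmid) ?_)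
      · have := factorAt_eq_iff.1 hz (k + 1) (by omega)
        convert this using 2 <;> omega
      · rwa [show z + 1 + n = z + (n + 1) by omega, show z' + 1 + n = z' + (n + 1) by omega]
      · rw [show i + 1 + n = i + n + 1 by omega, show j + 1 + n = j + n + 1 by omega]
        omega
  by_cases hc : w z = w i
  · refine hs.no_palindromic_bispecial hw (x := j) (fun k hk => ?_) (by omega) hz hz' (by omega)
      (fun k hk => (hzi k hk).trans (hmid k hk))
    rw [← hmid k hk, ← hmid _ (by omega), hpal k hk]
  · exact hs.no_palindromic_bispecial hw hpal (by omega) hz hz' hc hzi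

/-- The heights of equally long factors of a periodic word differ by a bounded amount. -/
theorem IsPeriodicWord.factorHeight_le_add {w : ℕ → ℕ} (hw : IsBinaryWord w) {T : ℕ}
    (hT : IsPeriodicWord w T) (i j r : ℕ) :
    factorHeight w i r ≤ factorHeight w j r + 2 * T := by
  have key : ∀ i, factorHeight w i r ≤ factorHeight w 0 r + T ∧
      factorHeight w 0 r ≤ factorHeight w i r + T := by
    intro i
    induction i using Nat.strong_induction_on with
    | _ i ih =>
    by_cases hi : i < T
    · have a1 := factorHeight_add w 0 r i
      have a2 := factorHeight_add w 0 i r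
      rw [add_comm i r] at a2
      simp only [zero_add] at a1 a2
      have := hw.factorHeight_le 0 i
      have := hw.factorHeight_le r i
      omega
    · have hT1 := hT.1
      have e : factorHeight w i r = factorHeight w (i - T) r := by
        refine Finset.sum_congr rfl fun l _ => ?_
        rw [← hT.2 (i - T + l)]
        congr 1
        omega
      rw [e]
      exact ih (i - T) (by omega)
  have := key i
  have := key j
  omega

/-- If the heights of equally long factors differ by at most `C`, then the height of a factor of
length `r` differs from `r * α` by at most `C`, where `α` is the slope. -/
theorem HasSlope.abs_factorHeight_sub_le {w : ℕ → ℕ} {α : ℝ} (hα : HasSlope w α) {C : ℕ}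
    (hC : ∀ i j r, factorHeight w i r ≤ factorHeight w j r + C) (i r : ℕ) :
    |(factorHeight w i r : ℝ) - r * α| ≤ C := by
  rcases Nat.eq_zero_or_pos r with rfl | hr
  · simp [factorHeight]
  have hr' : (0 : ℝ) < r := by exact_mod_cast hr
  have blocks : ∀ k : ℕ, |(factorHeight w 0 (k * r) : ℝ) - k * factorHeight w i r| ≤ k * C := by
    intro k
    induction k with
    | zero => simp [factorHeight]
    | succ k ih =>
      have h1 : (factorHeight w i r : ℝ) ≤ factorHeight w (0 + k * r) r + C := by
        exact_mod_cast hC _ _ _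
      have h2 : (factorHeight w (0 + k * r) r : ℝ) ≤ factorHeight w i r + C := by
        exact_mod_cast hC _ _ _
      rw [Nat.succ_mul, factorHeight_add]
      push_cast
      rw [abs_le] at ih ⊢
      constructor <;> linarith [ih.1, ih.2]
  have hlim : Filter.Tendsto (fun k : ℕ => (factorHeight w 0 (k * r) : ℝ) / (k * r : ℕ))
      Filter.atTop (nhds α) := by
    have := hα.comp (Filter.tendsto_id.atTop_mul_const' hr)
    simpa [factorHeight, Function.comp_def] using this
  have hlim' : Filter.Tendsto (fun k : ℕ => |(factorHeight w i r : ℝ) -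
      r * ((factorHeight w 0 (k * r) : ℝ) / (k * r : ℕ))|) Filter.atTop
      (nhds |(factorHeight w i r : ℝ) - r * α|) :=
    (tendsto_const_nhds.sub (hlim.const_mul _)).abs
  refine le_of_tendsto hlim' ?_
  filter_upwards [Filter.eventually_gt_atTop 0] with k hk
  have hk' : (0 : ℝ) < k := by exact_mod_cast hk
  have e : (factorHeight w i r : ℝ) - r * ((factorHeight w 0 (k * r) : ℝ) / (k * r : ℕ)) =
      -(((factorHeight w 0 (k * r) : ℝ) - k * factorHeight w i r) / k) := by
    push_cast
    field_simp
    ring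
  rw [e, abs_neg, abs_div, abs_of_pos hk', div_le_iff₀ hk', mul_comm (C : ℝ)]
  exact blocks k

theorem HasSlope.nonneg {w : ℕ → ℕ} {α : ℝ} (hα : HasSlope w α) : 0 ≤ α :=
  ge_of_tendsto' hα fun n => by positivity

/-- Let `m ≥ 2` and let `w` be Sturmian or periodic with slope `α`; set
`β = 1/(m+α)`. For every `ε > 0` there is `n₀` such that for all `n ≥ n₀`: whenever
`n = s₀ + s' + 2 + m·r + (w_{i+1} + ⋯ + w_{i+r})` with `0 ≤ s₀, s' ≤ m`, one has
`β - ε ≤ (r+1)/n ≤ β + ε`. -/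
theorem ratio_near_beta (m : ℕ) (hm : 2 ≤ m) (w : ℕ → ℕ) (hw : IsBinaryWord w)
    (hsp : IsSturmian w ∨ ∃ T, IsPeriodicWord w T)
    (α : ℝ) (hα : HasSlope w α) (β : ℝ) (hβ : β = 1 / (m + α)) :
    ∀ ε : ℝ, 0 < ε → ∃ n₀ : ℕ, ∀ n : ℕ, n₀ ≤ n →
      ∀ i r s₀ s' : ℕ, s₀ ≤ m → s' ≤ m →
        n = s₀ + s' + 2 + m * r + ∑ j ∈ Finset.range r, w (i + j) →
        β - ε ≤ ((r : ℝ) + 1) / n ∧ ((r : ℝ) + 1) / n ≤ β + ε := by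
  obtain ⟨C, hC⟩ : ∃ C : ℕ, ∀ i j r, factorHeight w i r ≤ factorHeight w j r + C := by
    rcases hsp with hs | ⟨T, hT⟩
    · exact ⟨1, hs.balanced hw⟩
    · exact ⟨2 * T, hT.factorHeight_le_add hw⟩
  intro ε hε
  have hα0 := hα.nonneg
  have hm' : (2 : ℝ) ≤ m := by exact_mod_cast hm
  have hpos : (1 : ℝ) ≤ m + α := by linarith
  set K : ℝ := 2 * m + 2 + (m + α) + C with hK
  obtain ⟨n₀, hn₀⟩ := exists_nat_ge (K / ε)
  refine ⟨n₀, fun n hn i r s₀ s' hs₀ hs' hsum => ?_⟩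
  have hdev := hα.abs_factorHeight_sub_le hC i r
  have hsum' : (n : ℝ) = s₀ + s' + 2 + m * r + factorHeight w i r := by
    rw [hsum, factorHeight]
    push_cast
    ring
  have hn0 : (0 : ℝ) < n := by
    have : 0 < n := by omega
    exact_mod_cast this
  have hKn : K ≤ ε * n := by
    have : (n₀ : ℝ) ≤ n := by exact_mod_cast hn
    rw [mul_comm]
    exact (div_le_iff₀ hε).1 (hn₀.trans this)
  have h1 : (s₀ : ℝ) ≤ m := by exact_mod_cast hs₀
  have h2 : (s' : ℝ) ≤ m := by exact_mod_cast hs'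
  have h3 : (0 : ℝ) ≤ s₀ := by positivity
  have h4 : (0 : ℝ) ≤ s' := by positivity
  have hεn : ε * n ≤ ε * n * (m + α) := le_mul_of_one_le_right (by positivity) hpos
  have hbound : |((r : ℝ) + 1) / n - β| ≤ ε := by
    have e : ((r : ℝ) + 1) / n - β = ((r + 1) * (m + α) - n) / (n * (m + α)) := by
      rw [hβ]
      field_simp
    rw [e, abs_div, abs_of_pos (show (0 : ℝ) < n * (m + α) by positivity),
      div_le_iff₀ (by positivity)]
    rw [abs_le] at hdev ⊢
    constructor <;> nlinarith [hdev.1, hdev.2]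
  rw [abs_le] at hbound
  constructor <;> linarith [hbound.1, hbound.2]
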